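/- Let ρ = e^{2πi/6} and let σ, τ act on ℂ[x₀, …, x₅] (indices mod 6) by σ: xᵢ ↦ xᵢ₊₁ and τ: xᵢ ↦ ρ^i xᵢ. There is no nonzero homogeneous polynomial F of degree 4 in ℂ[x₀, …, x₅] such that σ(F) = λF and τ(F) = μF for some scalars λ, μ ∈ ℂ. -/

import Mathlib

open MvPolynomial

/-- `ρ = e^{2πi/6}`. -/
noncomputable def rho6 : ℂ := Complex.exp (2 * Real.pi * Complex.I / 6)

/-- `σ : xᵢ ↦ xᵢ₊₁` on `ℂ[x₀,…,x₅]` (indices mod 6). -/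
noncomputable def sigmaP : MvPolynomial (ZMod 6) ℂ →ₐ[ℂ] MvPolynomial (ZMod 6) ℂ :=
  MvPolynomial.rename (fun i => i + 1)

/-- `τ : xᵢ ↦ ρ^i xᵢ` on `ℂ[x₀,…,x₅]`. -/
noncomputable def tauP : MvPolynomial (ZMod 6) ℂ →ₐ[ℂ] MvPolynomial (ZMod 6) ℂ :=
  MvPolynomial.aeval (fun i : ZMod 6 => C (rho6 ^ i.val) * X i)

lemma rho6_prim : IsPrimitiveRoot rho6 6 := by
  have := Complex.isPrimitiveRoot_exp 6 (by norm_num)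
  simpa [rho6] using this

lemma rho6_val (i : ZMod 6) : rho6 ^ (i + 1).val = rho6 ^ i.val * rho6 := by
  have h6 : rho6 ^ 6 = 1 := rho6_prim.pow_eq_one
  rw [ZMod.val_add, ← pow_succ, ← pow_mod_orderOf rho6 (i.val + 1), ← rho6_prim.eq_orderOf]
  rfl

/-- scaling -/
noncomputable def scaleP : MvPolynomial (ZMod 6) ℂ →ₐ[ℂ] MvPolynomial (ZMod 6) ℂ :=
  MvPolynomial.aeval (fun i : ZMod 6 => C rho6 * X i)

lemma scale_hom (F : MvPolynomial (ZMod 6) ℂ) (hF : F.IsHomogeneous 4) :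
    scaleP F = rho6 ^ 4 • F := by
  conv_lhs => rw [F.as_sum]
  conv_rhs => rw [F.as_sum]
  rw [map_sum, Finset.smul_sum]
  refine Finset.sum_congr rfl fun d hd => ?_
  have h4 : d.degree = 4 := by
    have := hF (mem_support_iff.mp hd)
    rw [Finsupp.degree_eq_weight_one]; exact this
  rw [scaleP, aeval_monomial, smul_eq_C_mul, monomial_eq]
  simp only [mul_pow, Finsupp.prod, Finset.prod_mul_distrib, Finset.prod_pow_eq_pow_sum]
  rw [← Finsupp.degree_apply, h4, algebraMap_eq, C_pow]
  ring

lemma comm_rel (F : MvPolynomial (ZMod 6) ℂ) :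
    tauP (sigmaP F) = sigmaP (tauP (scaleP F)) := by
  have : tauP.comp sigmaP = (sigmaP.comp tauP).comp scaleP := by
    apply MvPolynomial.algHom_ext
    intro i
    simp only [AlgHom.comp_apply, tauP, sigmaP, scaleP, aeval_X, rename_X, map_mul, rename_C,
      aeval_C, algebraMap_eq, rho6_val]
    ring
  exact DFunLike.congr_fun this F

lemma tau_inj (F : MvPolynomial (ZMod 6) ℂ) (h : tauP F = 0) : F = 0 := by
  have : (MvPolynomial.aeval (fun i : ZMod 6 => C ((rho6 ^ i.val)⁻¹) * X i) :
      MvPolynomial (ZMod 6) ℂ →ₐ[ℂ] MvPolynomial (ZMod 6) ℂ).comp tauP = AlgHom.id ℂ _ := by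
    apply MvPolynomial.algHom_ext
    intro i
    have h0 : rho6 ^ i.val ≠ 0 := pow_ne_zero _ (Complex.exp_ne_zero _)
    simp only [AlgHom.comp_apply, tauP, aeval_X, map_mul, aeval_C, algebraMap_eq, AlgHom.id_apply]
    rw [← mul_assoc, ← C_mul, mul_inv_cancel₀ h0, C_1, one_mul]
  have h2 := DFunLike.congr_fun this F
  rw [AlgHom.comp_apply, h, map_zero] at h2
  exact h2.symm

lemma sigma_inj (F : MvPolynomial (ZMod 6) ℂ) (h : sigmaP F = 0) : F = 0 :=
  rename_injective _ (add_left_injective (1 : ZMod 6)) (by simpa [sigmaP] using h)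

theorem stmt10 :
    ¬ ∃ (F : MvPolynomial (ZMod 6) ℂ) (lam mu : ℂ),
      F ≠ 0 ∧ F.IsHomogeneous 4 ∧ sigmaP F = lam • F ∧ tauP F = mu • F := by
  rintro ⟨F, lam, mu, h0, hF, hs, ht⟩
  have h := comm_rel F
  rw [scale_hom F hF, hs, map_smul, map_smul, ht, map_smul, map_smul, hs, smul_smul, smul_smul,
    smul_smul] at h
  have hl : lam ≠ 0 := by
    rintro rfl
    exact h0 (sigma_inj F (by rw [hs, zero_smul]))
  have hm : mu ≠ 0 := by
    rintro rfl
    exact h0 (tau_inj F (by rw [ht, zero_smul]))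
  have h1 : lam * mu = rho6 ^ 4 * mu * lam := smul_left_injective ℂ h0 h
  have h2 : rho6 ^ 4 = 1 := by
    apply mul_right_cancel₀ (mul_ne_zero hm hl)
    rw [← mul_assoc, ← h1]; ring
  have := rho6_prim.dvd_of_pow_eq_one 4 h2
  omega
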